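/- Let p ∈ ℂ[x] be nonzero with n = deg p and c ∈ ℂ such that p(x) = (−1)^n p(−x + c). Let 𝔭 = ⊕_{j∈ℤ} 𝔭_j be a ℤ-graded Lie subalgebra of 𝒟_p^± with 𝔭_0 = (𝒟_p^±)_0. If 𝔭_{−1} ≠ 0, then for every j ∈ ℕ the subspace 𝔭_{−j} is nonzero and has finite codimension in (𝒟_p^±)_{−j}. -/

import Mathlib

noncomputable section

/-- ℂ[t,t⁻¹] as a ℂ-vector space with basis {t^j}_{j∈ℤ}; t^j is `Finsupp.single j 1`. -/
abbrev LaurentV : Type := ℤ →₀ ℂ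

/-- The regular differential operator `t^k f(D)` (where D = t·d/dt), acting by
t^j ↦ f(j)·t^{j+k}. -/
def op (k : ℤ) (f : Polynomial ℂ) : Module.End ℂ LaurentV :=
  Finsupp.lsum ℂ fun j => f.eval (j : ℂ) • Finsupp.lsingle (j + k)

/-- The graded piece (𝒟ᵃ_p)_j = {t^j f(D) p(D) : f ∈ ℂ[x]}. -/
def Dgrade (p : Polynomial ℂ) (j : ℤ) : Submodule ℂ (Module.End ℂ LaurentV) :=
  Submodule.span ℂ {A | ∃ f : Polynomial ℂ, A = op j (f * p)}

/-- 𝒟ᵃ_p = 𝒟ᵃ·p(D). -/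
def Dp (p : Polynomial ℂ) : Submodule ℂ (Module.End ℂ LaurentV) :=
  Submodule.span ℂ {A | ∃ (k : ℤ) (f : Polynomial ℂ), A = op k (f * p)}

/-- σ is an anti-involution: it is ℂ-linear (built into the type), involutive, and
reverses products. -/
def IsAntiInvolutionOn (p : Polynomial ℂ) (σ : ↥(Dp p) →ₗ[ℂ] ↥(Dp p)) : Prop :=
  (∀ A : ↥(Dp p), σ (σ A) = A) ∧
  (∀ A B W : ↥(Dp p),
    (W : Module.End ℂ LaurentV) = (A : Module.End ℂ LaurentV) * (B : Module.End ℂ LaurentV) →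
    ((σ W : Module.End ℂ LaurentV)) = (σ B : Module.End ℂ LaurentV) * (σ A : Module.End ℂ LaurentV))

/-- σ preserves the principal ℤ-gradation. -/
def PreservesGrading (p : Polynomial ℂ) (σ : ↥(Dp p) →ₗ[ℂ] ↥(Dp p)) : Prop :=
  ∀ (j : ℤ) (A : ↥(Dp p)), (A : Module.End ℂ LaurentV) ∈ Dgrade p j →
    ((σ A : Module.End ℂ LaurentV)) ∈ Dgrade p j

/-- σ(t^k f(D) p(D)) = (-1)^{deg p}·e^k·t^k f(−D−k+c)p(D). -/
def SigmaFormula (p : Polynomial ℂ) (c e : ℂ) (σ : ↥(Dp p) →ₗ[ℂ] ↥(Dp p)) : Prop :=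
  ∀ (k : ℤ) (f : Polynomial ℂ) (A : ↥(Dp p)), (A : Module.End ℂ LaurentV) = op k (f * p) →
    ((σ A : Module.End ℂ LaurentV)) =
      ((-1 : ℂ) ^ p.natDegree * e ^ k) •
        op k ((f.comp (Polynomial.C (c - (k : ℂ)) - Polynomial.X)) * p)

/-- The graded piece (𝒟_p^±)_k = {d ∈ (𝒟_p)_k : σ_±(d) = −d}, as a set. -/
def DpmGradeSet (p : Polynomial ℂ) (c e : ℂ) (k : ℤ) : Set (Module.End ℂ LaurentV) :=
  {A | ∃ f : Polynomial ℂ, A = op k (f * p) ∧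
    ((-1 : ℂ) ^ p.natDegree * e ^ k) •
      op k ((f.comp (Polynomial.C (c - (k : ℂ)) - Polynomial.X)) * p) = -A}

/-- The graded piece (𝒟_p^±)_k, as a ℂ-subspace. -/
def DpmGrade (p : Polynomial ℂ) (c e : ℂ) (k : ℤ) : Submodule ℂ (Module.End ℂ LaurentV) :=
  Submodule.span ℂ (DpmGradeSet p c e k)

/-- V has finite codimension in W. -/
def FinCodimIn {M : Type*} [AddCommGroup M] [Module ℂ M] (V W : Submodule ℂ M) : Prop :=
  FiniteDimensional ℂ (↥W ⧸ Submodule.comap W.subtype V)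
open Polynomial

theorem op_single (k : ℤ) (f : ℂ[X]) (j : ℤ) (a : ℂ) :
    op k f (Finsupp.single j a) = Finsupp.single (j + k) (f.eval (j : ℂ) * a) := by
  simp [op]

theorem op_add (k : ℤ) (f g : ℂ[X]) : op k (f + g) = op k f + op k g := by
  refine Finsupp.lhom_ext fun j a => ?_
  simp only [LinearMap.add_apply, op_single, eval_add, add_mul, Finsupp.single_add]

theorem op_smul (k : ℤ) (r : ℂ) (f : ℂ[X]) : op k (r • f) = r • op k f := by
  refine Finsupp.lhom_ext fun j a => ?_
  simp only [LinearMap.smul_apply, op_single, eval_smul, Finsupp.smul_single, smul_eq_mul,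
    mul_assoc]

/-- `op k` as a linear map in the polynomial symbol. -/
def opLinear (k : ℤ) : ℂ[X] →ₗ[ℂ] Module.End ℂ LaurentV where
  toFun := op k
  map_add' := op_add k
  map_smul' := op_smul k

theorem op_injective (k : ℤ) : Function.Injective (op k) := by
  intro f g h
  refine Polynomial.eq_of_infinite_eval_eq f g ?_
  refine (Set.infinite_range_of_injective (Int.cast_injective (α := ℂ))).mono ?_
  rintro _ ⟨j, rfl⟩
  have hj := DFunLike.congr_fun (DFunLike.congr_fun h (Finsupp.single j 1)) (j + k)
  simpa [op_single] using hj

theorem op_zero (k : ℤ) : op k 0 = 0 := (opLinear k).map_zero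

/-- The commutator of homogeneous operators, with symbols written through shift differences. -/
theorem op_lie (i j : ℤ) (F G : ℂ[X]) :
    ⁅op i F, op j G⁆ = op (i + j) ((taylor (j : ℂ) F - F) * G - (taylor (i : ℂ) G - G) * F) := by
  refine Finsupp.lhom_ext fun m a => ?_
  rw [Ring.lie_def]
  simp only [LinearMap.sub_apply, Module.End.mul_apply, op_single]
  rw [show m + i + j = m + j + i by ring, show m + (i + j) = m + j + i by ring,
    ← Finsupp.single_sub]
  congr 1
  simp only [taylor_apply, eval_sub, eval_mul, eval_comp, eval_add, eval_X, eval_C, Int.cast_add]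
  ring

theorem natDegree_taylor_sub_le (r : ℂ) (f : ℂ[X]) :
    (taylor r f - f).natDegree ≤ f.natDegree - 1 := by
  rw [natDegree_le_iff_coeff_eq_zero]
  intro N hN
  rw [coeff_sub]
  rcases (show f.natDegree ≤ N by omega).eq_or_lt with h | h
  · subst h
    rw [coeff_taylor_natDegree, coeff_natDegree, sub_self]
  · rw [coeff_eq_zero_of_natDegree_lt h, coeff_eq_zero_of_natDegree_lt (by simpa using h), sub_self]

theorem coeff_taylor_sub (r : ℂ) (f : ℂ[X]) (hf : 1 ≤ f.natDegree) :
    (taylor r f - f).coeff (f.natDegree - 1) = r * f.natDegree * f.leadingCoeff := by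
  obtain ⟨d, hd⟩ : ∃ d, f.natDegree = d + 1 := ⟨f.natDegree - 1, by omega⟩
  have hdeg : (hasseDeriv d f).natDegree < 2 := by
    have := natDegree_hasseDeriv_le f d
    omega
  rw [coeff_sub, hd, Nat.add_sub_cancel, taylor_coeff, eval_eq_sum_range' hdeg, leadingCoeff, hd]
  simp [Finset.sum_range_succ, hasseDeriv_coeff, add_comm 1 d, Nat.choose_succ_self_right]
  ring

theorem natDegree_taylor_sub (r : ℂ) (hr : r ≠ 0) (f : ℂ[X]) (hf : 1 ≤ f.natDegree) :
    (taylor r f - f).natDegree = f.natDegree - 1 := by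
  refine natDegree_eq_of_le_of_coeff_ne_zero (natDegree_taylor_sub_le r f) ?_
  rw [coeff_taylor_sub r f hf]
  have : f ≠ 0 := by rintro rfl; simp at hf
  have h1 : (f.natDegree : ℂ) ≠ 0 := Nat.cast_ne_zero.mpr (by omega)
  exact mul_ne_zero (mul_ne_zero hr h1) (leadingCoeff_ne_zero.mpr this)

theorem lie_symbol_ne_zero (r s : ℂ) (F G : ℂ[X]) (hF : 1 ≤ F.natDegree) (hG : 1 ≤ G.natDegree)
    (h : r * F.natDegree ≠ s * G.natDegree) :
    (taylor r F - F) * G - (taylor s G - G) * F ≠ 0 := by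
  intro h0
  have h1 : ((taylor r F - F) * G).coeff (F.natDegree - 1 + G.natDegree) =
      r * F.natDegree * F.leadingCoeff * G.leadingCoeff := by
    rw [coeff_mul_add_eq_of_natDegree_le (natDegree_taylor_sub_le r F) le_rfl, coeff_taylor_sub r F hF,
      coeff_natDegree]
  have h2 : ((taylor s G - G) * F).coeff (F.natDegree - 1 + G.natDegree) =
      s * G.natDegree * G.leadingCoeff * F.leadingCoeff := by
    rw [show F.natDegree - 1 + G.natDegree = G.natDegree - 1 + F.natDegree by omega,
      coeff_mul_add_eq_of_natDegree_le (natDegree_taylor_sub_le s G) le_rfl, coeff_taylor_sub s G hG,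
      coeff_natDegree]
  have hF0 : F.leadingCoeff ≠ 0 := leadingCoeff_ne_zero.mpr (by rintro rfl; simp at hF)
  have hG0 : G.leadingCoeff ≠ 0 := leadingCoeff_ne_zero.mpr (by rintro rfl; simp at hG)
  have h3 := congrArg (fun q => coeff q (F.natDegree - 1 + G.natDegree)) h0
  simp only [coeff_sub, h1, h2, coeff_zero] at h3
  apply h
  have h4 : (r * F.natDegree - s * G.natDegree) * (F.leadingCoeff * G.leadingCoeff) = 0 := by
    linear_combination h3
  exact sub_eq_zero.mp ((mul_eq_zero.mp h4).resolve_right (mul_ne_zero hF0 hG0))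

theorem exists_symbol_of_mem_DpmGrade {p : ℂ[X]} (hp : p ≠ 0) {c e : ℂ} {k : ℤ}
    {x : Module.End ℂ LaurentV} (hx : x ∈ DpmGrade p c e k) :
    ∃ f : ℂ[X], x = op k (f * p) ∧
      ((-1 : ℂ) ^ p.natDegree * e ^ k) • f.comp (C (c - (k : ℂ)) - X) = -f := by
  induction hx using Submodule.span_induction with
  | mem x hx =>
    obtain ⟨f, rfl, hf⟩ := hx
    refine ⟨f, rfl, mul_right_cancel₀ hp (op_injective k ?_)⟩
    rw [smul_mul_assoc, op_smul, hf, neg_mul]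
    exact (map_neg (opLinear k) _).symm
  | zero => exact ⟨0, by simp [op_zero], by simp⟩
  | add x y _ _ hx hy =>
    obtain ⟨f, rfl, hf⟩ := hx
    obtain ⟨g, rfl, hg⟩ := hy
    refine ⟨f + g, by rw [add_mul, op_add], ?_⟩
    rw [add_comp, smul_add, hf, hg, neg_add]
  | smul a x _ hx =>
    obtain ⟨f, rfl, hf⟩ := hx
    refine ⟨a • f, by rw [smul_mul_assoc, op_smul], ?_⟩
    rw [smul_comp, smul_comm, hf, smul_neg]

theorem neg_one_pow_natDegree_of_op_mem {p : ℂ[X]} (hp : p ≠ 0) {c e : ℂ} {k : ℤ} {F : ℂ[X]}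
    (hF : op k F ∈ DpmGrade p c e k) (hF0 : F ≠ 0) :
    (-1 : ℂ) ^ F.natDegree * e ^ k = -1 := by
  obtain ⟨f, hf, hs⟩ := exists_symbol_of_mem_DpmGrade hp hF
  obtain rfl := op_injective k hf
  have hf0 : f ≠ 0 := left_ne_zero_of_mul hF0
  have hdeg : (C (c - (k : ℂ)) - X : ℂ[X]).natDegree = 1 := by
    rw [← neg_sub, natDegree_neg, natDegree_X_sub_C]
  have hlead : (C (c - (k : ℂ)) - X : ℂ[X]).leadingCoeff = -1 := by
    rw [← neg_sub, leadingCoeff_neg, leadingCoeff_X_sub_C]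
  have h := congrArg leadingCoeff hs
  rw [leadingCoeff_neg, smul_eq_C_mul, leadingCoeff_mul, leadingCoeff_C,
    leadingCoeff_comp (by rw [hdeg]; exact one_ne_zero), hlead] at h
  rw [natDegree_mul hf0 hp, pow_add]
  refine mul_right_cancel₀ (leadingCoeff_ne_zero.mpr hf0) ?_
  linear_combination h

theorem op_zero_mem_DpmGrade (p : ℂ[X]) (c e : ℂ) (m : ℕ)
    (hm : Odd (m + p.natDegree)) :
    op 0 ((X - C (c / 2)) ^ m * p) ∈ DpmGrade p c e 0 := by
  refine Submodule.subset_span ⟨(X - C (c / 2)) ^ m, rfl, ?_⟩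
  have h1 : ((X - C (c / 2)) ^ m : ℂ[X]).comp (C (c - ((0 : ℤ) : ℂ)) - X) =
      (-1 : ℂ) ^ m • (X - C (c / 2)) ^ m := by
    rw [pow_comp, sub_comp, X_comp, C_comp, Int.cast_zero, sub_zero, smul_eq_C_mul, C_pow,
      ← mul_pow]
    congr 1
    rw [show C c = C (c / 2) + C (c / 2) by rw [← C_add, add_halves], C_neg, C_1]
    ring
  rw [h1, smul_mul_assoc, op_smul, smul_smul, zpow_zero, mul_one, ← pow_add,
    add_comm, hm.neg_one_pow]
  exact neg_one_smul ℂ (M := Module.End ℂ LaurentV) _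

theorem exists_op_mem_natDegree_eq {p : ℂ[X]} (hp : p ≠ 0) {c e : ℂ}
    {𝔭 : ℤ → Submodule ℂ (Module.End ℂ LaurentV)}
    (hbrk : ∀ (i j : ℤ) (x y : Module.End ℂ LaurentV),
      x ∈ 𝔭 i → y ∈ 𝔭 j → ⁅x, y⁆ ∈ 𝔭 (i + j))
    (h0 : 𝔭 0 = DpmGrade p c e 0) {k : ℤ} (hk : k ≠ 0) {F : ℂ[X]} (hF : op k F ∈ 𝔭 k)
    (hF0 : F ≠ 0) (s : ℕ) (hs : p.natDegree ≤ 2 * s + 1) :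
    ∃ G : ℂ[X], op k G ∈ 𝔭 k ∧ G ≠ 0 ∧ G.natDegree = F.natDegree + 2 * s := by
  set m := 2 * s + 1 - p.natDegree with hm
  set A : ℂ[X] := (X - C (c / 2)) ^ m * p with hA
  have hmem : op 0 A ∈ 𝔭 0 := by
    rw [h0]
    exact op_zero_mem_DpmGrade p c e m ⟨s, by omega⟩
  have hAdeg : A.natDegree = 2 * s + 1 := by
    rw [hA, natDegree_mul (pow_ne_zero _ (X_sub_C_ne_zero _)) hp, natDegree_pow,
      natDegree_X_sub_C]
    omega
  have hk' : (k : ℂ) ≠ 0 := Int.cast_ne_zero.mpr hk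
  have hE : taylor (k : ℂ) A - A ≠ 0 := by
    intro h
    have h1 := coeff_taylor_sub (k : ℂ) A (by omega)
    rw [h, coeff_zero, eq_comm, mul_eq_zero, mul_eq_zero, leadingCoeff_eq_zero] at h1
    rcases h1 with (h1 | h1) | h1
    · exact hk' h1
    · rw [Nat.cast_eq_zero] at h1
      omega
    · rw [h1, natDegree_zero] at hAdeg
      omega
  refine ⟨(taylor (k : ℂ) A - A) * F, ?_, mul_ne_zero hE hF0, ?_⟩
  · have h := hbrk 0 k _ _ hmem hF
    rw [op_lie] at h
    simpa using h
  · rw [natDegree_mul hE hF0, natDegree_taylor_sub _ hk' A (by omega), hAdeg]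
    omega

theorem finCodimIn_of_le_sup {M : Type*} [AddCommGroup M] [Module ℂ M] {V W U : Submodule ℂ M}
    [FiniteDimensional ℂ U] (h : W ≤ V ⊔ U) : FinCodimIn V W := by
  have hker : Submodule.comap W.subtype V = LinearMap.ker (V.mkQ ∘ₗ W.subtype) := by
    rw [LinearMap.ker_comp, Submodule.ker_mkQ]
  have hle : LinearMap.range (V.mkQ ∘ₗ W.subtype) ≤ U.map V.mkQ := by
    rw [LinearMap.range_comp, Submodule.range_subtype]
    refine (Submodule.map_mono h).trans ?_
    rw [Submodule.map_sup, Submodule.mkQ_map_self, bot_sup_eq]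
  have : FiniteDimensional ℂ (LinearMap.range (V.mkQ ∘ₗ W.subtype)) :=
    Submodule.finiteDimensional_of_le hle
  rw [FinCodimIn, hker]
  exact (LinearMap.quotKerEquivRange (V.mkQ ∘ₗ W.subtype)).symm.finiteDimensional

/-- A subspace whose symbols realise all large degrees occurring in `W` has finite codimension. -/
theorem finCodimIn_of_natDegree {k : ℤ} {V W : Submodule ℂ (Module.End ℂ LaurentV)}
    (hVW : V ≤ W) (hW : ∀ x ∈ W, ∃ F : ℂ[X], x = op k F) (N : ℕ)
    (hN : ∀ H : ℂ[X], op k H ∈ W → N ≤ H.natDegree → H ≠ 0 →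
      ∃ G : ℂ[X], op k G ∈ V ∧ G ≠ 0 ∧ G.natDegree = H.natDegree) :
    FinCodimIn (M := Module.End ℂ LaurentV) V W := by
  have key : ∀ (d : ℕ) (H : ℂ[X]), op k H ∈ W → H ∈ degreeLT ℂ d →
      op k H ∈ V ⊔ (degreeLT ℂ N).map (opLinear k) := by
    intro d
    induction d with
    | zero =>
      intro H _ hd
      have : H = 0 := by simpa [mem_degreeLT, Nat.WithBot.lt_zero_iff] using hd
      rw [this, op_zero]
      exact zero_mem _
    | succ d ih =>
      intro H hH hd
      by_cases hH0 : H = 0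
      · rw [hH0, op_zero]
        exact zero_mem _
      by_cases hlt : H.natDegree < N
      · refine Submodule.mem_sup_right ⟨H, ?_, rfl⟩
        exact mem_degreeLT.mpr ((natDegree_lt_iff_degree_lt hH0).mp hlt)
      obtain ⟨G, hG, hG0, hGd⟩ := hN H hH (not_lt.mp hlt) hH0
      have hGl := leadingCoeff_ne_zero.mpr hG0
      set r := H.leadingCoeff / G.leadingCoeff with hr
      have hr0 : r ≠ 0 := div_ne_zero (leadingCoeff_ne_zero.mpr hH0) hGl
      have hsplit : op k H = op k (H - r • G) + r • op k G := by
        rw [← op_smul, ← op_add, sub_add_cancel]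
      have hmem : op k (H - r • G) ∈ W := by
        rw [sub_eq_add_neg, ← neg_smul, op_add, op_smul]
        exact add_mem hH (W.smul_mem (-r) (hVW hG))
      have hdlt : (H - r • G).degree < H.degree := by
        refine degree_sub_lt_left ?_ hH0 ?_
        · rw [degree_smul_of_smul_regular _ (IsSMulRegular.of_ne_zero hr0),
            degree_eq_natDegree hH0, degree_eq_natDegree hG0, hGd]
        · rw [smul_eq_C_mul, leadingCoeff_mul, leadingCoeff_C, hr, div_mul_cancel₀ _ hGl]
      rw [hsplit]
      refine add_mem (ih _ hmem ?_) (Submodule.smul_mem _ _ (Submodule.mem_sup_left hG))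
      rw [mem_degreeLT] at hd ⊢
      refine hdlt.trans_le ?_
      rw [degree_eq_natDegree hH0] at hd ⊢
      norm_cast at hd ⊢
      omega
  have : FiniteDimensional ℂ (degreeLT ℂ N) :=
    (degreeLTEquiv ℂ N).symm.finiteDimensional
  refine finCodimIn_of_le_sup (U := (degreeLT ℂ N).map (opLinear k)) fun x hx => ?_
  obtain ⟨F, rfl⟩ := hW x hx
  refine key (F.natDegree + 1) F hx (mem_degreeLT.mpr ?_)
  exact degree_le_natDegree.trans_lt (by exact_mod_cast F.natDegree.lt_succ_self)

theorem graded_subalgebra_neg_finite_codim (p : Polynomial ℂ) (hp : p ≠ 0) (c : ℂ)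
    (hpc : ∀ x : ℂ, p.eval x = (-1 : ℂ) ^ p.natDegree * p.eval (-x + c))
    (e : ℂ) (he : e = 1 ∨ e = -1)
    (𝔭 : ℤ → Submodule ℂ (Module.End ℂ LaurentV))
    (hsub : ∀ j : ℤ, 𝔭 j ≤ DpmGrade p c e j)
    (hbrk : ∀ (i j : ℤ) (x y : Module.End ℂ LaurentV),
      x ∈ 𝔭 i → y ∈ 𝔭 j → ⁅x, y⁆ ∈ 𝔭 (i + j))
    (h0 : 𝔭 0 = DpmGrade p c e 0)
    (hne : 𝔭 (-1) ≠ ⊥) :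
    ∀ j : ℕ, 1 ≤ j →
      𝔭 (-(j : ℤ)) ≠ ⊥ ∧ FinCodimIn (M := Module.End ℂ LaurentV) (𝔭 (-(j : ℤ))) (DpmGrade p c e (-(j : ℤ))) := by
  have hsym : ∀ (k : ℤ), ∀ x ∈ DpmGrade p c e k, ∃ F : Polynomial ℂ, x = op k F :=
    fun k x hx => let ⟨f, hf, _⟩ := exists_symbol_of_mem_DpmGrade hp hx; ⟨f * p, hf⟩
  have hsymbol : ∀ k : ℤ, 𝔭 k ≠ ⊥ → ∃ F : Polynomial ℂ, op k F ∈ 𝔭 k ∧ F ≠ 0 := by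
    intro k hk
    obtain ⟨x, hx, hx0⟩ := Submodule.exists_mem_ne_zero_of_ne_bot hk
    obtain ⟨F, rfl⟩ := hsym k x (hsub k hx)
    exact ⟨F, hx, by rintro rfl; exact hx0 (op_zero k)⟩
  have hnonzero : ∀ j : ℕ, 1 ≤ j → 𝔭 (-(j : ℤ)) ≠ ⊥ := by
    intro j hj
    induction j, hj using Nat.le_induction with
    | base => simpa using hne
    | succ j hj ih =>
      have hj0 : -(j : ℤ) ≠ 0 := by omega
      obtain ⟨G₀, hG₀, hG₀0⟩ := hsymbol _ ih
      obtain ⟨G, hG, -, hGd⟩ := exists_op_mem_natDegree_eq hp hbrk h0 hj0 hG₀ hG₀0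
        (p.natDegree + 1) (by omega)
      obtain ⟨F₀, hF₀, hF₀0⟩ := hsymbol _ hne
      obtain ⟨F, hF, -, hFd⟩ := exists_op_mem_natDegree_eq hp hbrk h0 (by norm_num) hF₀ hF₀0
        (p.natDegree + 1 + G.natDegree) (by omega)
      have hmem := hbrk _ _ _ _ hF hG
      rw [op_lie, show (-1 : ℤ) + -(j : ℤ) = -((j + 1 : ℕ) : ℤ) by push_cast; ring] at hmem
      intro hbot
      rw [hbot, Submodule.mem_bot, ← op_zero (-((j + 1 : ℕ) : ℤ))] at hmem
      refine lie_symbol_ne_zero _ _ F G (by omega) (by omega) ?_ (op_injective _ hmem)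
      intro h
      have h' : j * F.natDegree = G.natDegree := by
        have : (j : ℂ) * F.natDegree = G.natDegree := by
          push_cast at h
          linear_combination -h
        exact_mod_cast this
      nlinarith
  intro j hj
  refine ⟨hnonzero j hj, ?_⟩
  have hj0 : -(j : ℤ) ≠ 0 := by omega
  obtain ⟨F, hF, hF0⟩ := hsymbol _ (hnonzero j hj)
  refine finCodimIn_of_natDegree (hsub _) (hsym _) (F.natDegree + p.natDegree) ?_
  intro H hH hdeg hH0
  have he0 : e ^ (-(j : ℤ)) ≠ 0 := zpow_ne_zero _ (by rcases he with rfl | rfl <;> norm_num)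
  have hparity : (-1 : ℂ) ^ H.natDegree = (-1) ^ F.natDegree :=
    mul_right_cancel₀ he0 ((neg_one_pow_natDegree_of_op_mem hp hH hH0).trans
      (neg_one_pow_natDegree_of_op_mem hp (hsub _ hF) hF0).symm)
  obtain ⟨d, hd⟩ := Nat.exists_eq_add_of_le (show F.natDegree ≤ H.natDegree by omega)
  have hd_even : Even d := by
    rw [hd, pow_add] at hparity
    have h1 : (-1 : ℂ) ^ d = 1 :=
      mul_left_cancel₀ (pow_ne_zero F.natDegree (by norm_num : (-1 : ℂ) ≠ 0))
        (hparity.trans (mul_one _).symm)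
    exact (neg_one_pow_eq_one_iff_even (by norm_num)).mp h1
  obtain ⟨s, hs⟩ := hd_even
  obtain ⟨G, hG, hG0, hGd⟩ := exists_op_mem_natDegree_eq hp hbrk h0 hj0 hF hF0 s (by omega)
  exact ⟨G, hG, hG0, by omega⟩

end
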